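/- There is no connected graph G on n vertices with 2 ≤ n ≤ 6 such that the full vertex set of G is a (1, ≤2)-identifying set; moreover the cycle C_7 is a connected graph on 7 vertices whose full vertex set is (1, ≤2)-identifying. Hence the smallest order n ≥ 2 of a connected graph admitting a (1, ≤2)-identifying set is 7. -/

import Mathlib

open Set

variable {V : Type*}

/-- The closed neighbourhood `N[x]` of a vertex. -/
def closedNbhd (G : SimpleGraph V) (x : V) : Set V :=
  insert x (G.neighborSet x)

/-- `C` is an identifying set: all sets `N[x] ∩ C` are nonempty and pairwise distinct. -/
def IsIdentifying (G : SimpleGraph V) (C : Set V) : Prop :=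
  (∀ x : V, (closedNbhd G x ∩ C).Nonempty) ∧
    ∀ x y : V, closedNbhd G x ∩ C = closedNbhd G y ∩ C → x = y

/-- Every `k`-subset of vertices is an identifying set. -/
def EveryKIdentifying (G : SimpleGraph V) (k : ℕ) : Prop :=
  ∀ C : Set V, C.ncard = k → IsIdentifying G C

/-- `N[X] = ⋃ x ∈ X, N[x]`. -/
def nbhdSet (G : SimpleGraph V) (X : Set V) : Set V :=
  ⋃ x ∈ X, closedNbhd G x

/-- `C` is `(1, ≤ ℓ)`-identifying. -/
def IsLIdentifying (G : SimpleGraph V) (ℓ : ℕ) (C : Set V) : Prop :=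
  ∀ X Y : Set V, X.ncard ≤ ℓ → Y.ncard ≤ ℓ → X ≠ Y →
    nbhdSet G X ∩ C ≠ nbhdSet G Y ∩ C

/-- Every `k`-subset of vertices is a `(1, ≤ ℓ)`-identifying set. -/
def EveryKLIdentifying (G : SimpleGraph V) (k ℓ : ℕ) : Prop :=
  ∀ C : Set V, C.ncard = k → IsLIdentifying G ℓ C

theorem mem_nbhdSet_iff {V : Type*} (G : SimpleGraph V) (X : Set V) (v : V) :
    v ∈ nbhdSet G X ↔ ∃ x ∈ X, v = x ∨ G.Adj x v := by
  simp [nbhdSet, closedNbhd]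

theorem ncard_le_two_cases {V : Type*} [Finite V] (X : Set V) (h : X.ncard ≤ 2) :
    X = ∅ ∨ ∃ a b, X = {a, b} := by
  have : X.ncard = 0 ∨ X.ncard = 1 ∨ X.ncard = 2 := by omega
  rcases this with h | h | h
  · left; exact (Set.ncard_eq_zero (Set.toFinite X)).1 h
  · obtain ⟨a, rfl⟩ := Set.ncard_eq_one.1 h
    exact Or.inr ⟨a, a, by simp⟩
  · obtain ⟨a, b, _, rfl⟩ := Set.ncard_eq_two.1 h
    exact Or.inr ⟨a, b, rfl⟩

theorem cycle_seven_pairs : ∀ a b c d : Fin 7,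
    (∀ v : Fin 7, ((v = a ∨ (SimpleGraph.cycleGraph 7).Adj a v) ∨
        (v = b ∨ (SimpleGraph.cycleGraph 7).Adj b v)) ↔
      ((v = c ∨ (SimpleGraph.cycleGraph 7).Adj c v) ∨
        (v = d ∨ (SimpleGraph.cycleGraph 7).Adj d v))) →
    (a = c ∧ b = d) ∨ (a = d ∧ b = c) ∨ (a = b ∧ c = d ∧ a = c) := by
  decide +kernel

theorem cycle_seven_ident : IsLIdentifying (SimpleGraph.cycleGraph 7) 2 Set.univ := by
  intro X Y hX hY hne heq
  simp only [Set.inter_univ] at heq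
  have key : ∀ v, (∃ x ∈ X, v = x ∨ (SimpleGraph.cycleGraph 7).Adj x v) ↔
      (∃ x ∈ Y, v = x ∨ (SimpleGraph.cycleGraph 7).Adj x v) := by
    intro v
    rw [← mem_nbhdSet_iff, ← mem_nbhdSet_iff, heq]
  rcases ncard_le_two_cases X hX with rfl | ⟨a, b, rfl⟩
  · rcases ncard_le_two_cases Y hY with rfl | ⟨c, d, rfl⟩
    · exact hne rfl
    · obtain ⟨x, hx, _⟩ := (key c).2 ⟨c, by simp, Or.inl rfl⟩
      exact hx
  · rcases ncard_le_two_cases Y hY with rfl | ⟨c, d, rfl⟩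
    · obtain ⟨x, hx, _⟩ := (key a).1 ⟨a, by simp, Or.inl rfl⟩
      exact hx
    · have := cycle_seven_pairs a b c d (by
        intro v
        have := key v
        simpa only [Set.mem_insert_iff, Set.mem_singleton_iff, exists_eq_or_imp,
          exists_eq_left] using this)
      rcases this with ⟨rfl, rfl⟩ | ⟨rfl, rfl⟩ | ⟨rfl, rfl, rfl⟩
      · exact hne rfl
      · exact hne (Set.pair_comm _ _)
      · exact hne rfl

/-- In a connected graph on at least two vertices whose vertex set is identifying, every closed
neighbourhood has at least three elements. -/
theorem three_le_closed {W : Type*} [Fintype W] [DecidableEq W] (G : SimpleGraph W)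
    [DecidableRel G.Adj] (h2 : 2 ≤ Fintype.card W)
    (hG : G.Connected) (hI : IsLIdentifying G 2 Set.univ) (v : W) :
    3 ≤ (Finset.univ.filter fun x => v = x ∨ G.Adj x v).card := by
  have : Nontrivial W := Fintype.one_lt_card_iff_nontrivial.1 (by omega)
  obtain ⟨y, hy⟩ := hG.preconnected.exists_adj_of_nontrivial v
  by_contra hlt
  have hsub : ({v, y} : Finset W) ⊆ Finset.univ.filter fun x => v = x ∨ G.Adj x v := by
    intro x hx
    simp only [Finset.mem_insert, Finset.mem_singleton] at hx
    rcases hx with rfl | rfl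
    · simp
    · simp [hy.symm]
  have heq := Finset.eq_of_subset_of_card_le hsub (by rw [Finset.card_pair hy.ne]; omega)
  have hnb : ∀ x, G.Adj v x → x = y := by
    intro x hx
    have : x ∈ ({v, y} : Finset W) := by rw [heq]; simp [hx.symm]
    simp only [Finset.mem_insert, Finset.mem_singleton] at this
    rcases this with rfl | h
    · exact absurd rfl hx.ne
    · exact h
  refine hI {v, y} {y} (by rw [Set.ncard_pair hy.ne]) (by simp) ?_ ?_
  · intro h
    have : v ∈ ({y} : Set W) := by rw [← h]; simp
    exact hy.ne this
  · congr 1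
    ext u
    simp only [mem_nbhdSet_iff, Set.mem_insert_iff, Set.mem_singleton_iff, exists_eq_or_imp,
      exists_eq_left]
    constructor
    · rintro ((rfl | h) | h)
      · exact Or.inr hy.symm
      · exact Or.inl (hnb u h)
      · exact h
    · exact Or.inr

theorem small_not_ident (W : Type) [Fintype W] (G : SimpleGraph W) (h2 : 2 ≤ Fintype.card W)
    (h6 : Fintype.card W ≤ 6) (hG : G.Connected) : ¬ IsLIdentifying G 2 Set.univ := by
  classical
  intro hI
  have hdeg := three_le_closed G h2 hG hI
  -- the non-dominators of `v`
  let N : W → Finset W := fun v => Finset.univ.filter fun x => ¬ (v = x ∨ G.Adj x v)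
  have hN : ∀ v, (N v).card + 3 ≤ Fintype.card W := by
    intro v
    have := Finset.card_filter_add_card_filter_not (s := (Finset.univ : Finset W))
      (fun x => v = x ∨ G.Adj x v)
    have h3 := hdeg v
    rw [Finset.card_univ] at this
    simp only [N]
    omega
  let P : Finset (Finset W) := Finset.univ.powersetCard 2
  let M : Finset W → Finset W := fun p => Finset.univ.filter fun v => p ⊆ N v
  have hPcard : P.card = (Fintype.card W).choose 2 := by simp [P]
  have hinj : ∀ p ∈ P, ∀ q ∈ P, M p = M q → p = q := by
    intro p hp q hq hM
    have hp2 := (Finset.mem_powersetCard.1 hp).2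
    have hq2 := (Finset.mem_powersetCard.1 hq).2
    by_contra hne
    refine hI (p : Set W) (q : Set W) (by simp [hp2]) (by simp [hq2])
      (fun h => hne (Finset.coe_injective h)) ?_
    congr 1
    ext v
    have hv : v ∈ M p ↔ v ∈ M q := by rw [hM]
    rw [← not_iff_not]
    simpa [mem_nbhdSet_iff, M, N, Finset.subset_iff] using hv
  have hcount : ∑ p ∈ P, (M p).card = ∑ v, (N v).card.choose 2 := by
    have h1 := Finset.sum_card_bipartiteAbove_eq_sum_card_bipartiteBelow
      (s := P) (t := (Finset.univ : Finset W)) (fun p v => p ⊆ N v)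
    simp only [Finset.bipartiteAbove, Finset.bipartiteBelow] at h1
    rw [show ∑ p ∈ P, (M p).card = _ from h1]
    refine Finset.sum_congr rfl fun v _ => ?_
    rw [← Finset.card_powersetCard]
    congr 1
    ext p
    simp [P, Finset.mem_powersetCard, and_comm]
  have hle : ∀ k, (P.filter fun p => (M p).card = k).card ≤ (Fintype.card W).choose k := by
    intro k
    rw [← Finset.card_univ, ← Finset.card_powersetCard]
    refine Finset.card_le_card_of_injOn M ?_ ?_
    · intro p hp
      have := (Finset.mem_filter.1 hp).2
      simp [this]
    · intro p hp q hq h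
      exact hinj p (Finset.mem_filter.1 hp).1 q (Finset.mem_filter.1 hq).1 h
  have hlow : 2 * P.card ≤ ∑ p ∈ P, (M p).card
      + 2 * (P.filter fun p => (M p).card = 0).card
      + (P.filter fun p => (M p).card = 1).card := by
    rw [Finset.card_filter, Finset.card_filter, Finset.mul_sum, ← Finset.sum_add_distrib,
      ← Finset.sum_add_distrib, mul_comm, ← smul_eq_mul]
    refine Finset.card_nsmul_le_sum _ _ _ fun p _ => ?_
    split_ifs <;> omega
  have hup : ∑ v, (N v).card.choose 2 ≤
      Fintype.card W * (Fintype.card W - 3).choose 2 := by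
    rw [← smul_eq_mul, ← Finset.card_univ]
    refine Finset.sum_le_card_nsmul _ _ _ fun v _ => ?_
    refine Nat.choose_le_choose 2 ?_
    have := hN v
    rw [Finset.card_univ]
    omega
  have h0 := hle 0
  have h1 := hle 1
  obtain ⟨v⟩ := hG.nonempty
  have hv := hN v
  rw [hcount, hPcard] at hlow
  generalize Fintype.card W = n at *
  clear_value N P M
  generalize ∑ v, (N v).card.choose 2 = S at *
  generalize (P.filter fun p => (M p).card = 0).card = A at *
  generalize (P.filter fun p => (M p).card = 1).card = B at *
  clear hcount hle hN hinj hPcard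
  interval_cases n <;> norm_num [Nat.choose] at hlow hup h0 h1 <;> omega

theorem stmt19 :
    (∀ (W : Type) [Fintype W] (G : SimpleGraph W), 2 ≤ Fintype.card W →
        Fintype.card W ≤ 6 → G.Connected → ¬ IsLIdentifying G 2 Set.univ) ∧
      (SimpleGraph.cycleGraph 7).Connected ∧
      IsLIdentifying (SimpleGraph.cycleGraph 7) 2 Set.univ := by
  exact ⟨fun W _ G h2 h6 hG => small_not_ident W G h2 h6 hG,
    SimpleGraph.cycleGraph_connected, cycle_seven_ident⟩
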